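/- For every 1 ≤ K < M, the increment vanishes exactly when the new singular value is zero: PER_{K+1} − PER_K = 0 if and only if σ K = 0 (i.e., the (K+1)-st singular value, indexed from zero, is zero). -/

import Mathlib

/-- The Partial Effective Rank of a sequence of singular values `σ : Fin M → ℝ`,
truncated to the first `K` values: `PER_K = exp(H(p_{K,1}, …, p_{K,K}))` where
`p_{K,k} = σ k / (σ 0 + ⋯ + σ (K-1))` and `H` is the Shannon entropy with the
convention `0 * log 0 = 0` (note `Real.log 0 = 0` in Mathlib). -/
noncomputable def PER {M : ℕ} (σ : Fin M → ℝ) (K : ℕ) (h : K ≤ M) : ℝ :=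
  Real.exp (-∑ k : Fin K,
    (σ (Fin.castLE h k) / ∑ j : Fin K, σ (Fin.castLE h j)) *
      Real.log (σ (Fin.castLE h k) / ∑ j : Fin K, σ (Fin.castLE h j)))

/-- The entropy of the normalization of `f` in terms of the unnormalized weights. -/
theorem neg_sum_div_mul_log_div {ι : Type*} [Fintype ι] (f : ι → ℝ) (hS : ∑ j, f j ≠ 0) :
    -∑ k, (f k / ∑ j, f j) * Real.log (f k / ∑ j, f j) =
      Real.log (∑ j, f j) - (∑ k, f k * Real.log (f k)) / ∑ j, f j := by
  set S := ∑ j, f j with hSdef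
  have hterm : ∀ k, (f k / S) * Real.log (f k / S) =
      f k * Real.log (f k) / S - f k * (Real.log S / S) := by
    intro k
    by_cases hk : f k = 0
    · simp [hk]
    · rw [Real.log_div hk hS]
      ring
  simp_rw [hterm]
  rw [Finset.sum_sub_distrib, ← Finset.sum_div, ← Finset.sum_mul, ← hSdef]
  field_simp
  ring

/-- Adding a positive weight `x` that does not exceed any of the weights summing to `S`
strictly increases the entropy; here `T` is the sum of `w * log w` over the old weights `w`. -/
theorem log_sub_div_lt_log_add_sub_div {S T x : ℝ} (hS : 0 < S) (hx : 0 < x)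
    (hT : S * Real.log x ≤ T) :
    Real.log S - T / S < Real.log (S + x) - (T + x * Real.log x) / (S + x) := by
  have hlog : Real.log S < Real.log (S + x) := Real.log_lt_log hS (by linarith)
  have hdiv : (T + x * Real.log x) / (S + x) ≤ T / S := by
    rw [div_le_div_iff₀ (by positivity) hS]
    nlinarith [mul_le_mul_of_nonneg_left hT hx.le]
  linarith

/-- For every `1 ≤ K < M`, the increment of the Partial Effective Rank vanishes
exactly when the new singular value is zero:
`PER_{K+1} − PER_K = 0 ↔ σ K = 0` (the `(K+1)`-st singular value, indexed from zero). -/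
theorem per_increment_eq_zero_iff {M : ℕ} (σ : Fin M → ℝ) (hmono : Antitone σ)
    (hnonneg : ∀ i, 0 ≤ σ i) (hM : 0 < M) (hpos : 0 < σ ⟨0, hM⟩)
    (K : ℕ) (hK1 : 1 ≤ K) (hKM : K < M) :
    PER σ (K + 1) hKM - PER σ K (le_of_lt hKM) = 0 ↔ σ ⟨K, hKM⟩ = 0 := by
  set f : Fin K → ℝ := fun k => σ (Fin.castLE hKM.le k) with hf
  set x := σ ⟨K, hKM⟩ with hx
  have hS : 0 < ∑ j, f j :=
    Finset.sum_pos' (fun j _ => hnonneg _) ⟨⟨0, hK1⟩, Finset.mem_univ _, hpos⟩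
  have hxnonneg : 0 ≤ x := hnonneg _
  have hsum : ∑ j : Fin (K + 1), σ (Fin.castLE hKM j) = (∑ j, f j) + x :=
    Fin.sum_univ_castSucc _
  have hsum_log : ∑ j : Fin (K + 1), σ (Fin.castLE hKM j) * Real.log (σ (Fin.castLE hKM j)) =
      (∑ j, f j * Real.log (f j)) + x * Real.log x :=
    Fin.sum_univ_castSucc _
  have hold := neg_sum_div_mul_log_div f hS.ne'
  have hnew := neg_sum_div_mul_log_div (fun k : Fin (K + 1) => σ (Fin.castLE hKM k))
    (by rw [hsum]; positivity)
  simp only [hsum_log] at hnew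
  rw [sub_eq_zero, PER, PER, Real.exp_eq_exp, hold, hnew, hsum]
  constructor
  · intro h
    by_contra hne
    have hxpos : 0 < x := lt_of_le_of_ne hxnonneg (Ne.symm hne)
    refine (log_sub_div_lt_log_add_sub_div hS hxpos ?_).ne' h
    rw [Finset.sum_mul]
    refine Finset.sum_le_sum fun k _ => ?_
    have hle : x ≤ f k := hmono (Fin.mk_le_mk.mpr k.isLt.le)
    exact mul_le_mul_of_nonneg_left (Real.log_le_log hxpos hle) (hnonneg _)
  · intro h
    simp [h]
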